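/- arXiv:1510.06559 — 2 statements merged into one kernel-verified Lean document; each statement's English description precedes it below -/
import Mathlib

section
/- Let f be an entire function of exponential type with ∫_ℝ log⁺|f(iy)|/(1+y²) dy < ∞ (Cartwright class). If f vanishes on all of ℕ, then f is identically zero on ℂ. -/
open MeasureTheory

/-- exponentially small shift -/
noncomputable def cwEps (A η t : ℝ) : ℝ := η * Real.exp (-(A * |t|))

lemma cwEps_pos {A η : ℝ} (hη : 0 < η) (t : ℝ) : 0 < cwEps A η t := by
  unfold cwEps; positivity

lemma cwEps_le {A η : ℝ} (hA : 0 < A) (hη : 0 < η) (hη1 : η ≤ 1) (t : ℝ) : cwEps A η t ≤ 1 := by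
  unfold cwEps
  have h1 : Real.exp (-(A * |t|)) ≤ 1 := by
    rw [Real.exp_le_one_iff]
    have : 0 ≤ A * |t| := by positivity
    linarith
  nlinarith [Real.exp_pos (-(A * |t|))]

lemma cwEps_anti {A η : ℝ} (hA : 0 < A) (hη : 0 < η) {s t : ℝ} (h : |s| ≤ |t|) :
    cwEps A η t ≤ cwEps A η s := by
  unfold cwEps
  gcongr

lemma cwEps_cont (A η : ℝ) : Continuous (cwEps A η) := by
  unfold cwEps; fun_prop

/-- denominators -/
noncomputable def cwDen (A η : ℝ) (z : ℂ) (t : ℝ) : ℂ := z + (cwEps A η t : ℂ) - Complex.I * t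

lemma cwDen_re (A η : ℝ) (z : ℂ) (t : ℝ) : (cwDen A η z t).re = z.re + cwEps A η t := by
  simp [cwDen]

lemma cwDen_im (A η : ℝ) (z : ℂ) (t : ℝ) : (cwDen A η z t).im = z.im - t := by
  simp [cwDen]

lemma cwDen_lower {A η : ℝ} (hA : 0 < A) (hη : 0 < η) (z₀ : ℂ) (hz : 0 ≤ z₀.re) :
    ∃ r > 0, ∃ c > 0, ∀ z ∈ Metric.ball z₀ r, ∀ t : ℝ, c * (1 + |t|) ≤ ‖cwDen A η z t‖ := by
  set R : ℝ := ‖z₀‖ + 1 with hR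
  have hR1 : 1 ≤ R := by simp [hR]
  set r : ℝ := min 1 (cwEps A η (2 * R) / 2) with hr
  have he := cwEps_pos (A := A) hη (2 * R)
  have hr0 : 0 < r := by simp [hr]; linarith
  have hr1 : r ≤ 1 := min_le_left _ _
  have hr2 : r ≤ cwEps A η (2 * R) / 2 := min_le_right _ _
  refine ⟨r, hr0, min (r / (1 + 2 * R)) (1 / 4), by positivity, ?_⟩
  intro z hzz t
  have hd : ‖z - z₀‖ < r := by simpa [dist_eq_norm] using hzz
  have ht0 := abs_nonneg t
  by_cases ht : |t| ≤ 2 * R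
  · have h1 : cwEps A η (2 * R) ≤ cwEps A η t := by
      apply cwEps_anti hA hη
      rwa [abs_of_nonneg (by linarith : 0 ≤ 2 * R)]
    have h2 : -r ≤ z.re := by
      have := (abs_le.mp (Complex.abs_re_le_norm (z - z₀))).1
      simp at this
      linarith
    have h3 : r ≤ ‖cwDen A η z t‖ := by
      have := (abs_le.mp (Complex.abs_re_le_norm (cwDen A η z t))).2
      rw [cwDen_re] at this
      linarith
    calc min (r / (1 + 2 * R)) (1 / 4) * (1 + |t|) ≤ r / (1 + 2 * R) * (1 + 2 * R) := by
          gcongr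
          exact min_le_left _ _
      _ = r := by field_simp
      _ ≤ _ := h3
  · push Not at ht
    have h2 : |z.im| ≤ R := by
      have h4 := Complex.abs_im_le_norm z
      have h5 : ‖z‖ ≤ ‖z - z₀‖ + ‖z₀‖ := by simpa using norm_add_le (z - z₀) z₀
      linarith
    have h3 := Complex.abs_im_le_norm (cwDen A η z t)
    rw [cwDen_im] at h3
    have h6 : |t| - |z.im| ≤ |z.im - t| := by
      rw [abs_sub_comm]; exact abs_sub_abs_le_abs_sub _ _
    calc min (r / (1 + 2 * R)) (1 / 4) * (1 + |t|) ≤ 1 / 4 * (1 + |t|) := by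
          gcongr
          exact min_le_right _ _
      _ ≤ _ := by linarith

/-- modified Cauchy kernel -/
noncomputable def cwK (A η : ℝ) (z : ℂ) (t : ℝ) : ℂ :=
  (cwDen A η z t)⁻¹ - Complex.I * ((t / (1 + t ^ 2) : ℝ) : ℂ)

lemma cwK_re (A η : ℝ) (z : ℂ) (t : ℝ) :
    (cwK A η z t).re = (z.re + cwEps A η t) / ((z.re + cwEps A η t) ^ 2 + (z.im - t) ^ 2) := by
  unfold cwK
  rw [Complex.sub_re, Complex.inv_re, Complex.normSq_apply, cwDen_re, cwDen_im, Complex.re_mul_ofReal]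
  simp [pow_two]

lemma cwK_re_nonneg {A η : ℝ} (hη : 0 < η) (z : ℂ) (hz : 0 ≤ z.re) (t : ℝ) :
    0 ≤ (cwK A η z t).re := by
  rw [cwK_re]
  have := cwEps_pos (A := A) hη t
  positivity

lemma cwK_bound {A η : ℝ} (hA : 0 < A) (hη : 0 < η) (hη1 : η ≤ 1) (z : ℂ) (hz : 0 ≤ z.re) :
    ∃ M > 0, ∀ t : ℝ, ‖cwK A η z t‖ ≤ M * (1 / (1 + t ^ 2)) := by
  obtain ⟨r, hr, c, hc, h⟩ := cwDen_lower hA hη z hz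
  refine ⟨(‖1 - z‖ + 1) / c + 1, by positivity, fun t => ?_⟩
  have hd := h z (Metric.mem_ball_self hr) t
  have hs : 0 < 1 + t ^ 2 := by positivity
  set w : ℂ := 1 - Complex.I * t with hw
  have hwn2 : ‖w‖ ^ 2 = 1 + t ^ 2 := by
    rw [← Complex.normSq_eq_norm_sq, Complex.normSq_apply]; simp [hw]; ring
  have hwn : ‖w‖ ≤ 1 + |t| := by
    apply abs_le_of_sq_le_sq' _ (by positivity) |>.2
    rw [hwn2]; nlinarith [abs_nonneg t, sq_abs t]
  have hwpos : 0 < ‖w‖ := by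
    rcases (norm_nonneg w).eq_or_lt with h0 | h0
    · rw [← h0] at hwn2; nlinarith
    · exact h0
  have hw0 : w ≠ 0 := norm_pos_iff.mp hwpos
  have hdpos : 0 < ‖cwDen A η z t‖ := lt_of_lt_of_le (by positivity) hd
  have hD0 : cwDen A η z t ≠ 0 := norm_pos_iff.mp hdpos
  have hC : (1 + (t : ℂ) ^ 2) ≠ 0 := by exact_mod_cast hs.ne'
  have hprod : w * (1 + Complex.I * t) = 1 + (t : ℂ) ^ 2 := by
    rw [hw]; ring_nf; rw [Complex.I_sq]; ring
  have hwinv : w⁻¹ = (1 + Complex.I * t) / (1 + (t : ℂ) ^ 2) := by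
    rw [eq_div_iff hC, ← hprod]; field_simp
  have key : cwK A η z t = (1 - z - cwEps A η t) / (cwDen A η z t * w) + 1 / (1 + (t : ℂ) ^ 2) := by
    have e1 : (1 - z - cwEps A η t : ℂ) = w - cwDen A η z t := by
      rw [hw, cwDen]; ring
    have e2 : (w - cwDen A η z t) / (cwDen A η z t * w) = (cwDen A η z t)⁻¹ - w⁻¹ := by
      field_simp
    rw [e1, e2, hwinv, cwK]
    push_cast
    ring
  rw [key]
  have hn : ‖(1 + (t : ℂ) ^ 2)‖ = 1 + t ^ 2 := by
    rw [← Complex.ofReal_pow, ← Complex.ofReal_one, ← Complex.ofReal_add, Complex.norm_real]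
    exact abs_of_pos hs
  have h1 : ‖(1 - z - cwEps A η t : ℂ)‖ ≤ ‖1 - z‖ + 1 := by
    refine (norm_sub_le _ _).trans ?_
    gcongr
    rw [Complex.norm_real, Real.norm_eq_abs, abs_of_pos (cwEps_pos hη t)]
    exact cwEps_le hA hη hη1 t
  have h2 : c * (1 + t ^ 2) ≤ ‖cwDen A η z t‖ * ‖w‖ := by
    rw [← hwn2]
    have : c * ‖w‖ ≤ ‖cwDen A η z t‖ := le_trans (by gcongr) hd
    nlinarith
  refine (norm_add_le _ _).trans ?_
  rw [norm_div, norm_div, hn, norm_mul, norm_one, add_mul, one_mul]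
  gcongr
  calc _ ≤ (‖1 - z‖ + 1) / (c * (1 + t ^ 2)) := by gcongr
    _ = _ := by field_simp

lemma cwDen_cont (A η : ℝ) (z : ℂ) : Continuous (cwDen A η z) := by
  unfold cwDen
  have := cwEps_cont A η
  fun_prop

lemma cwDen_ne {A η : ℝ} (hη : 0 < η) (z : ℂ) (hz : 0 ≤ z.re) (t : ℝ) : cwDen A η z t ≠ 0 := by
  intro h
  have := cwDen_re A η z t
  rw [h] at this
  have := cwEps_pos (A := A) hη t
  simp at *
  linarith

lemma cwK_meas (A η : ℝ) (z : ℂ) : Measurable (cwK A η z) := by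
  unfold cwK
  have := (cwDen_cont A η z).measurable
  fun_prop

/-- the analytic function whose real part majorizes u -/
noncomputable def cwV (A η : ℝ) (u : ℝ → ℝ) (z : ℂ) : ℂ := ∫ t : ℝ, (u t : ℂ) * cwK A η z t

lemma cwV_int {A η : ℝ} (hA : 0 < A) (hη : 0 < η) (hη1 : η ≤ 1) {u : ℝ → ℝ}
    (huc : Continuous u) (hu : Integrable (fun t : ℝ => u t / (1 + t ^ 2)))
    (z : ℂ) (hz : 0 ≤ z.re) : Integrable (fun t : ℝ => (u t : ℂ) * cwK A η z t) := by
  obtain ⟨M, hM, h⟩ := cwK_bound hA hη hη1 z hz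
  refine Integrable.mono' (hu.norm.const_mul M) ?_ ?_
  · have := cwK_meas A η z
    have := huc.measurable
    exact (by fun_prop : Measurable _).aestronglyMeasurable
  · refine Filter.Eventually.of_forall fun t => ?_
    have hs : 0 < 1 + t ^ 2 := by positivity
    rw [norm_mul, Complex.norm_real, norm_div, Real.norm_of_nonneg hs.le]
    calc _ ≤ ‖u t‖ * (M * (1 / (1 + t ^ 2))) := by gcongr; exact h t
      _ = _ := by ring

lemma cwV_diff {A η : ℝ} (hA : 0 < A) (hη : 0 < η) (hη1 : η ≤ 1) {u : ℝ → ℝ}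
    (huc : Continuous u) (hu : Integrable (fun t : ℝ => u t / (1 + t ^ 2)))
    (z : ℂ) (hz : 0 ≤ z.re) : DifferentiableAt ℂ (cwV A η u) z := by
  obtain ⟨r, hr, c, hc, h⟩ := cwDen_lower hA hη z hz
  have hm := huc.measurable
  have := hasDerivAt_integral_of_dominated_loc_of_deriv_le (μ := volume) (𝕜 := ℂ)
    (F := fun z t => (u t : ℂ) * cwK A η z t)
    (F' := fun z t => (u t : ℂ) * (-1 / (cwDen A η z t) ^ 2)) (x₀ := z) (s := Metric.ball z r)
    (bound := fun t => (1 / c ^ 2) * ‖u t / (1 + t ^ 2)‖)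
    (Metric.ball_mem_nhds z hr) ?_ (cwV_int hA hη hη1 huc hu z hz) ?_ ?_ ?_ ?_
  · exact this.2.differentiableAt
  · refine Filter.Eventually.of_forall fun w => ?_
    have := cwK_meas A η w
    exact (by fun_prop : Measurable _).aestronglyMeasurable
  · have := (cwDen_cont A η z).measurable
    exact (by fun_prop : Measurable _).aestronglyMeasurable
  · refine Filter.Eventually.of_forall fun t w hw => ?_
    have hs : 0 < 1 + t ^ 2 := by positivity
    have hd := h w hw t
    rw [norm_mul, Complex.norm_real, norm_div, norm_div, Real.norm_of_nonneg hs.le, norm_neg,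
      norm_one, norm_pow]
    have h2 : c ^ 2 * (1 + t ^ 2) ≤ ‖cwDen A η w t‖ ^ 2 := by
      calc c ^ 2 * (1 + t ^ 2) ≤ (c * (1 + |t|)) ^ 2 := by
            rw [mul_pow]; gcongr; nlinarith [abs_nonneg t, sq_abs t]
        _ ≤ _ := by gcongr
    calc _ ≤ ‖u t‖ * (1 / (c ^ 2 * (1 + t ^ 2))) := by gcongr
      _ = _ := by field_simp
  · exact hu.norm.const_mul _
  · refine Filter.Eventually.of_forall fun t w hw => ?_
    have hd := h w hw t
    have hne : cwDen A η w t ≠ 0 := norm_pos_iff.mp (lt_of_lt_of_le (by positivity) hd)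
    have h1 : HasDerivAt (fun w => cwDen A η w t) 1 w := by
      unfold cwDen
      exact ((hasDerivAt_id w).add_const _).sub_const _
    have h2 := h1.inv hne
    unfold cwK
    exact (h2.sub_const _).const_mul _

lemma cwV_re {A η : ℝ} (hA : 0 < A) (hη : 0 < η) (hη1 : η ≤ 1) {u : ℝ → ℝ}
    (huc : Continuous u) (hu : Integrable (fun t : ℝ => u t / (1 + t ^ 2)))
    (z : ℂ) (hz : 0 ≤ z.re) :
    Integrable (fun t : ℝ => u t * (cwK A η z t).re) ∧
    (cwV A η u z).re = ∫ t : ℝ, u t * (cwK A η z t).re := by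
  have hi := cwV_int hA hη hη1 huc hu z hz
  have e : (fun t : ℝ => u t * (cwK A η z t).re) = fun t => ((u t : ℂ) * cwK A η z t).re := by
    funext t; simp
  rw [e]
  refine ⟨hi.re, ?_⟩
  exact (Complex.reCLM.integral_comp_comm hi).symm

lemma cwV_re_nonneg {A η : ℝ} (hA : 0 < A) (hη : 0 < η) (hη1 : η ≤ 1) {u : ℝ → ℝ}
    (huc : Continuous u) (hu : Integrable (fun t : ℝ => u t / (1 + t ^ 2))) (hu0 : ∀ t, 0 ≤ u t)
    (z : ℂ) (hz : 0 ≤ z.re) : 0 ≤ (cwV A η u z).re := by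
  rw [(cwV_re hA hη hη1 huc hu z hz).2]
  exact integral_nonneg fun t => mul_nonneg (hu0 t) (cwK_re_nonneg hη z hz t)

lemma cwV_lower {A η : ℝ} (hA : 0 < A) (hη : 0 < η) (hη1 : η ≤ 1) {u : ℝ → ℝ}
    (huc : Continuous u) (hu : Integrable (fun t : ℝ => u t / (1 + t ^ 2))) (hu0 : ∀ t, 0 ≤ u t)
    (y : ℝ) (hy : ∀ s, |s - y| ≤ cwEps A η y → u y - 1 ≤ u s) :
    u y - 1 ≤ (Real.exp A * (Real.exp A ^ 2 + 1)) * (cwV A η u (y * Complex.I)).re := by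
  have hz : 0 ≤ ((y : ℂ) * Complex.I).re := by simp
  have hnn := cwV_re_nonneg hA hη hη1 huc hu hu0 _ hz
  set E := Real.exp A with hE
  have hE0 : 0 < E := Real.exp_pos A
  by_cases hy1 : u y - 1 ≤ 0
  · exact hy1.trans (by positivity)
  push Not at hy1
  obtain ⟨hint, hre⟩ := cwV_re hA hη hη1 huc hu _ hz
  set e := cwEps A η y with he
  have he0 : 0 < e := cwEps_pos hη y
  have he1 : e ≤ 1 := cwEps_le hA hη hη1 y
  have h1 : ∫ t in Set.Icc (y - e) (y + e), (u y - 1) * (1 / (E * (E ^ 2 + 1) * e)) ≤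
      ∫ t in Set.Icc (y - e) (y + e), u t * (cwK A η (y * Complex.I) t).re := by
    apply setIntegral_mono_on
    · exact continuous_const.integrableOn_Icc
    · exact hint.integrableOn
    · exact measurableSet_Icc
    intro t ht
    have hty : |t - y| ≤ e := by rw [abs_le]; constructor <;> linarith [ht.1, ht.2]
    have hb1 : |t| ≤ |y| + 1 := by
      have := abs_sub_abs_le_abs_sub t y; linarith
    have hb2 : |y| ≤ |t| + 1 := by
      have := abs_sub_abs_le_abs_sub y t; rw [abs_sub_comm] at this; linarith
    have hexp : ∀ a b : ℝ, |a| ≤ |b| + 1 → cwEps A η b ≤ E * cwEps A η a := by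
      intro a b hab
      unfold cwEps
      rw [hE, mul_left_comm, ← Real.exp_add]
      gcongr
      nlinarith
    have g1 : cwEps A η t ≤ E * e := hexp y t hb2
    have g2 : e ≤ E * cwEps A η t := hexp t y hb1
    have ht0 := cwEps_pos (A := A) hη t
    refine mul_le_mul (hy t hty) ?_ (by positivity) (hu0 t)
    rw [cwK_re]
    simp only [Complex.re_ofReal_mul, Complex.I_re, mul_zero, zero_add, Complex.im_ofReal_mul, Complex.I_im, mul_one]
    rw [div_le_div_iff₀ (by positivity) (by positivity)]
    have g3 : (cwEps A η t) ^ 2 ≤ E ^ 2 * e ^ 2 := by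
      rw [← mul_pow]; gcongr
    have g4 : (y - t) ^ 2 ≤ e ^ 2 := by
      rw [abs_sub_comm] at hty; exact sq_le_sq' (abs_le.mp hty).1 (abs_le.mp hty).2
    calc 1 * (cwEps A η t ^ 2 + (y - t) ^ 2) ≤ (E ^ 2 + 1) * e * e := by nlinarith
      _ ≤ (E ^ 2 + 1) * e * (E * cwEps A η t) := by gcongr
      _ = _ := by ring
  have h2 : ∫ t in Set.Icc (y - e) (y + e), u t * (cwK A η (y * Complex.I) t).re ≤
      (cwV A η u (y * Complex.I)).re := by
    rw [hre]
    apply setIntegral_le_integral hint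
    exact Filter.Eventually.of_forall fun t => mul_nonneg (hu0 t) (cwK_re_nonneg hη _ hz t)
  have h3 : ∫ t in Set.Icc (y - e) (y + e), (u y - 1) * (1 / (E * (E ^ 2 + 1) * e)) =
      2 * (u y - 1) / (E * (E ^ 2 + 1)) := by
    rw [setIntegral_const, Real.volume_real_Icc_of_le (by linarith), smul_eq_mul]
    field_simp
    ring
  rw [h3] at h1
  have h4 := h1.trans h2
  rw [div_le_iff₀ (by positivity)] at h4
  linarith

lemma cw_PL {A η c K R : ℝ} (hA : 0 < A) (hη : 0 < η) (hη1 : η ≤ 1) (hc : 0 ≤ c) {u : ℝ → ℝ}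
    (huc : Continuous u) (hu : Integrable (fun t : ℝ => u t / (1 + t ^ 2))) (hu0 : ∀ t, 0 ≤ u t)
    (hV : ∀ y : ℝ, u y - 1 ≤ c * (cwV A η u (y * Complex.I)).re)
    {g : ℂ → ℂ} (hg : Differentiable ℂ g)
    (hgrow : ∀ z : ℂ, R ≤ ‖z‖ → ‖g z‖ ≤ K * Real.exp (A * ‖z‖))
    (hbd : ∀ y : ℝ, ‖g (y * Complex.I)‖ ≤ Real.exp (u y))
    (z : ℂ) (hz : 0 ≤ z.re) :
    ‖g z‖ ≤ Real.exp (1 + A * z.re + c * (cwV A η u z).re) := by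
  set V := cwV A η u with hVdef
  have hVd : ∀ z : ℂ, 0 ≤ z.re → DifferentiableAt ℂ V z := fun z hz =>
    cwV_diff hA hη hη1 huc hu z hz
  have hV0 : ∀ z : ℂ, 0 ≤ z.re → 0 ≤ (V z).re := fun z hz =>
    cwV_re_nonneg hA hη hη1 huc hu hu0 z hz
  set h : ℂ → ℂ := fun z => g z * Complex.exp (-(A * z + c * V z)) with hh
  have hnorm : ∀ z : ℂ, ‖h z‖ = ‖g z‖ * Real.exp (-(A * z.re + c * (V z).re)) := by
    intro z
    simp [hh, Complex.norm_exp]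
  have hhd : ∀ z : ℂ, 0 ≤ z.re → DifferentiableAt ℂ h z := by
    intro z hz
    have h1 := hVd z hz
    have h2 := hg z
    fun_prop
  have hle : ∀ z : ℂ, 0 ≤ z.re → ‖h z‖ ≤ ‖g z‖ * Real.exp (-(A * z.re)) := by
    intro z hz
    rw [hnorm]
    have := hV0 z hz
    have : 0 ≤ c * (V z).re := by positivity
    gcongr
    linarith
  have key : ‖h z‖ ≤ Real.exp 1 := by
    apply PhragmenLindelof.right_half_plane_of_bounded_on_real (f := h)
    · apply DifferentiableOn.diffContOnCl
      rw [Complex.closure_setOfPred_lt_re]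
      exact fun z hz => (hhd z hz).differentiableWithinAt
    · refine ⟨1, by norm_num, A, ?_⟩
      refine Asymptotics.IsBigO.of_bound K ?_
      rw [Filter.eventually_inf_principal]
      filter_upwards [tendsto_norm_cobounded_atTop.eventually_ge_atTop R] with z hzR hz0
      have hz0 : 0 < z.re := hz0
      refine (hle z hz0.le).trans ?_
      rw [Real.rpow_one, Real.norm_of_nonneg (Real.exp_pos _).le]
      refine le_trans ?_ (hgrow z hzR)
      apply mul_le_of_le_one_right (norm_nonneg _)
      rw [Real.exp_le_one_iff]
      have : 0 < A * z.re := by positivity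
      linarith
    · refine Filter.isBoundedUnder_of_eventually_le (a := K) ?_
      filter_upwards [Filter.eventually_ge_atTop R, Filter.eventually_ge_atTop 0] with x hx hx0
      have hn : ‖(x : ℂ)‖ = x := by rw [Complex.norm_real, Real.norm_of_nonneg hx0]
      refine (hle x (by simpa using hx0)).trans ?_
      have := hgrow x (by rwa [hn])
      rw [hn] at this
      calc _ ≤ K * Real.exp (A * x) * Real.exp (-(A * (x : ℂ).re)) := by gcongr
        _ = K := by rw [Complex.ofReal_re, mul_assoc, ← Real.exp_add]; simp
    · intro y
      rw [hnorm]
      calc _ ≤ Real.exp (u y) * Real.exp (-(A * ((y : ℂ) * Complex.I).re + c * (V (y * Complex.I)).re)) := by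
            gcongr; exact hbd y
        _ ≤ _ := by
          rw [← Real.exp_add]
          gcongr
          have := hV y
          simp only [Complex.re_ofReal_mul, Complex.I_re, mul_zero]
          linarith
    · exact hz
  rw [hnorm] at key
  have e : ‖g z‖ = ‖g z‖ * Real.exp (-(A * z.re + c * (V z).re)) * Real.exp (A * z.re + c * (V z).re) := by
    rw [mul_assoc, ← Real.exp_add]; simp
  rw [e, show 1 + A * z.re + c * (V z).re = 1 + (A * z.re + c * (V z).re) by ring, Real.exp_add 1]
  gcongr

lemma cw_factor {f : ℂ → ℂ} (hf : Differentiable ℂ f) (hzero : ∀ n : ℕ, f (n : ℂ) = 0) (N : ℕ) :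
    ∃ G : ℂ → ℂ, Differentiable ℂ G ∧
      ∀ z, f z = (∏ i ∈ Finset.range N, (z - ((i + 1 : ℕ) : ℂ))) * G z := by
  induction N with
  | zero => exact ⟨f, hf, by simp⟩
  | succ N ih =>
    obtain ⟨G, hG, hfG⟩ := ih
    have h0 : G ((N + 1 : ℕ) : ℂ) = 0 := by
      have h1 := hfG ((N + 1 : ℕ) : ℂ)
      rw [hzero] at h1
      rcases mul_eq_zero.mp h1.symm with h2 | h2
      · rw [Finset.prod_eq_zero_iff] at h2
        obtain ⟨i, hi, h3⟩ := h2
        rw [Finset.mem_range] at hi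
        rw [sub_eq_zero] at h3
        have := Nat.cast_injective h3
        omega
      · exact h2
    refine ⟨dslope G ((N + 1 : ℕ) : ℂ), ?_, fun z => ?_⟩
    · rw [← differentiableOn_univ]
      rw [Complex.differentiableOn_dslope Filter.univ_mem]
      exact hG.differentiableOn
    · rw [Finset.prod_range_succ, hfG z, mul_assoc]
      congr 1
      have := sub_smul_dslope G ((N + 1 : ℕ) : ℂ) z
      rw [h0, sub_zero, smul_eq_mul] at this
      exact this.symm

lemma cw_lip {f : ℂ → ℂ} (hf : Differentiable ℂ f) {A C : ℝ} (hA : 0 < A) (hC : 0 < C)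
    (hb : ∀ z : ℂ, ‖f z‖ ≤ C * Real.exp (A * ‖z‖)) (s y : ℝ) (hs : |s - y| ≤ 1) :
    ‖f (Complex.I * y) - f (Complex.I * s)‖ ≤ C * Real.exp (A * (|y| + 2)) * |s - y| := by
  have hmem : Complex.I * (s : ℂ) ∈ Metric.closedBall (Complex.I * (y : ℂ)) 1 := by
    rw [Metric.mem_closedBall, dist_eq_norm, ← mul_sub, ← Complex.ofReal_sub, norm_mul,
      Complex.norm_I, Complex.norm_real, one_mul]
    exact hs
  have := (convex_closedBall (Complex.I * (y : ℂ)) 1).norm_image_sub_le_of_norm_deriv_le (f := f)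
    (C := C * Real.exp (A * (|y| + 2)))
    (fun x _ => hf x) ?_ hmem (Metric.mem_closedBall_self zero_le_one)
  · rw [← mul_sub, ← Complex.ofReal_sub, norm_mul, Complex.norm_I, Complex.norm_real, one_mul,
      Real.norm_eq_abs, abs_sub_comm y s] at this
    exact this
  · intro w hw
    have hw1 : ‖w‖ ≤ |y| + 1 := by
      rw [Metric.mem_closedBall, dist_eq_norm] at hw
      have h1 := norm_add_le (w - Complex.I * y) (Complex.I * y)
      simp at h1
      linarith
    have := Complex.norm_deriv_le_of_forall_mem_sphere_norm_le (f := f) (c := w) (R := 1)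
      (C := C * Real.exp (A * (|y| + 2))) one_pos hf.diffContOnCl ?_
    · simpa using this
    · intro z hz
      refine (hb z).trans ?_
      rw [mem_sphere_iff_norm] at hz
      have h1 := norm_add_le (z - w) w
      simp at h1
      gcongr
      linarith

lemma cw_real {x : ℝ} (hx0 : 0 < x) (hx1 : x < 1) (N : ℕ) :
    ‖∏ i ∈ Finset.range N, ((x : ℂ) - ((i + 1 : ℕ) : ℂ))‖ ≤
      Real.exp (-(x * ∑ i ∈ Finset.range N, (1 / (i + 1) : ℝ))) *
      ‖∏ i ∈ Finset.range N, ((x : ℂ) + ((i + 1 : ℕ) : ℂ))‖ := by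
  rw [Finset.mul_sum, ← Finset.sum_neg_distrib, Real.exp_sum, norm_prod, norm_prod,
    ← Finset.prod_mul_distrib]
  apply Finset.prod_le_prod
  · intro i _; positivity
  · intro i _
    have e1 : ‖(x : ℂ) - ((i + 1 : ℕ) : ℂ)‖ = (i + 1) - x := by
      have : (x : ℂ) - ((i + 1 : ℕ) : ℂ) = ((x - (i + 1) : ℝ) : ℂ) := by push_cast; ring
      rw [this, Complex.norm_real, Real.norm_eq_abs, abs_sub_comm, abs_of_nonneg]
      have : (0 : ℝ) ≤ i := by positivity
      linarith
    have e2 : ‖(x : ℂ) + ((i + 1 : ℕ) : ℂ)‖ = (i + 1) + x := by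
      have : (x : ℂ) + ((i + 1 : ℕ) : ℂ) = (((i + 1) + x : ℝ) : ℂ) := by push_cast; ring
      rw [this, Complex.norm_real, Real.norm_eq_abs, abs_of_nonneg (by positivity)]
    rw [e1, e2]
    have hi : (1 : ℝ) ≤ i + 1 := by
      have : (0 : ℝ) ≤ i := by positivity
      linarith
    have h1 := Real.add_one_le_exp (-(x * (1 / (i + 1) : ℝ)))
    refine le_trans ?_ (mul_le_mul_of_nonneg_right h1 (by positivity))
    have : (-(x * (1 / ((i : ℝ) + 1))) + 1) * (i + 1 + x) = (i + 1) - x ^ 2 / (i + 1) := by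
      field_simp; ring
    rw [this]
    have : x ^ 2 / ((i : ℝ) + 1) ≤ x := by
      rw [div_le_iff₀ (by positivity)]; nlinarith
    linarith

/-- Uniqueness theorem for the Cartwright class: an entire function of exponential
type with `∫_ℝ log⁺|f(iy)|/(1+y²) dy < ∞` that vanishes on all of `ℕ` is
identically zero. -/
theorem stmt_4
    (f : ℂ → ℂ)
    (hf : Differentiable ℂ f)
    (htype : ∃ A C : ℝ, 0 < A ∧ 0 < C ∧ ∀ z : ℂ, ‖f z‖ ≤ C * Real.exp (A * ‖z‖))
    (hlog : Integrable
      (fun y : ℝ => Real.log (max ‖f (Complex.I * (y : ℂ))‖ 1) / (1 + y ^ 2)))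
    (hzero : ∀ n : ℕ, f (n : ℂ) = 0) :
    ∀ z : ℂ, f z = 0 := by
  obtain ⟨A, C, hA, hC, hb⟩ := htype
  set u : ℝ → ℝ := fun y => Real.log (max ‖f (Complex.I * (y : ℂ))‖ 1) with hu
  have hu0 : ∀ t, 0 ≤ u t := fun t => Real.log_nonneg (le_max_right _ _)
  have hfc := hf.continuous
  have huc : Continuous u := by
    refine Continuous.log (by fun_prop) fun t => ?_
    exact (lt_of_lt_of_le one_pos (le_max_right _ _)).ne'
  have hexpu : ∀ t, Real.exp (u t) = max ‖f (Complex.I * (t : ℂ))‖ 1 := fun t =>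
    Real.exp_log (lt_of_lt_of_le one_pos (le_max_right _ _))
  set η : ℝ := min 1 (Real.exp (-(2 * A)) / C) with hη
  have hη0 : 0 < η := by positivity
  have hη1 : η ≤ 1 := min_le_left _ _
  have hη2 : C * η ≤ Real.exp (-(2 * A)) := by
    have := min_le_right 1 (Real.exp (-(2 * A)) / C)
    rw [le_div_iff₀ hC] at this
    linarith
  have hloc : ∀ y s, |s - y| ≤ cwEps A η y → u y - 1 ≤ u s := by
    intro y s hs
    have h1 : ‖f (Complex.I * y) - f (Complex.I * s)‖ ≤ 1 := by
      refine (cw_lip hf hA hC hb s y (hs.trans (cwEps_le hA hη0 hη1 y))).trans ?_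
      calc _ ≤ C * Real.exp (A * (|y| + 2)) * cwEps A η y := by gcongr
        _ = (C * η) * (Real.exp (A * (|y| + 2)) * Real.exp (-(A * |y|))) := by
          unfold cwEps; ring
        _ ≤ Real.exp (-(2 * A)) * (Real.exp (A * (|y| + 2)) * Real.exp (-(A * |y|))) := by gcongr
        _ = 1 := by
          rw [← Real.exp_add, ← Real.exp_add, Real.exp_eq_one_iff]; ring
    have h2 := norm_sub_norm_le (f (Complex.I * y)) (f (Complex.I * s))
    have h3 : Real.exp (u y) ≤ Real.exp (1 + u s) := by
      rw [Real.exp_add, hexpu, hexpu]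
      have h4 := Real.exp_one_gt_d9
      have h5 := le_max_left ‖f (Complex.I * (s : ℂ))‖ 1
      have h6 := le_max_right ‖f (Complex.I * (s : ℂ))‖ 1
      apply max_le <;> nlinarith
    have := Real.exp_le_exp.mp h3
    linarith
  set c : ℝ := Real.exp A * (Real.exp A ^ 2 + 1) with hc
  have hc0 : 0 ≤ c := by positivity
  have hV : ∀ y : ℝ, u y - 1 ≤ c * (cwV A η u (y * Complex.I)).re := fun y =>
    cwV_lower hA hη0 hη1 huc hlog hu0 y (hloc y)
  have hmain : ∀ x : ℝ, 0 < x → x < 1 → f x = 0 := by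
    intro x hx0 hx1
    set M := Real.exp (1 + A * (x : ℂ).re + c * (cwV A η u x).re) with hM
    have hN : ∀ N : ℕ, ‖f x‖ ≤ Real.exp (-(x * ∑ i ∈ Finset.range N, (1 / (i + 1) : ℝ))) * M := by
      intro N
      obtain ⟨G, hG, hfG⟩ := cw_factor hf hzero N
      set g : ℂ → ℂ := fun z => (∏ i ∈ Finset.range N, (z + ((i + 1 : ℕ) : ℂ))) * G z with hg
      have hgd : Differentiable ℂ g := by
        refine Differentiable.mul ?_ hG
        fun_prop
      have hgM : ‖g x‖ ≤ M := by
        refine cw_PL (K := 4 ^ N * C) (R := 2 * N) hA hη0 hη1 hc0 huc hlog hu0 hV hgd ?_ ?_ x (by simpa using hx0.le)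
        · intro z hz
          have h1 : ‖∏ i ∈ Finset.range N, (z + ((i + 1 : ℕ) : ℂ))‖ ≤
              4 ^ N * ‖∏ i ∈ Finset.range N, (z - ((i + 1 : ℕ) : ℂ))‖ := by
            have : (4 : ℝ) ^ N = ∏ i ∈ Finset.range N, (4 : ℝ) := by simp
            rw [this, norm_prod, norm_prod, ← Finset.prod_mul_distrib]
            apply Finset.prod_le_prod
            · intro i _; positivity
            · intro i hi
              rw [Finset.mem_range] at hi
              have hi' : ((i + 1 : ℕ) : ℝ) ≤ N := by exact_mod_cast hi
              have h2 := norm_add_le z ((i + 1 : ℕ) : ℂ)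
              have h3 := norm_sub_norm_le z ((i + 1 : ℕ) : ℂ)
              rw [Complex.norm_natCast] at h2 h3
              linarith
          calc ‖g z‖ = ‖∏ i ∈ Finset.range N, (z + ((i + 1 : ℕ) : ℂ))‖ * ‖G z‖ := norm_mul _ _
            _ ≤ 4 ^ N * ‖∏ i ∈ Finset.range N, (z - ((i + 1 : ℕ) : ℂ))‖ * ‖G z‖ := by gcongr
            _ = 4 ^ N * ‖f z‖ := by rw [hfG z, norm_mul]; ring
            _ ≤ 4 ^ N * (C * Real.exp (A * ‖z‖)) := by gcongr; exact hb z
            _ = _ := by ring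
        · intro y
          have h1 : ‖∏ i ∈ Finset.range N, ((y : ℂ) * Complex.I + ((i + 1 : ℕ) : ℂ))‖ =
              ‖∏ i ∈ Finset.range N, ((y : ℂ) * Complex.I - ((i + 1 : ℕ) : ℂ))‖ := by
            rw [norm_prod, norm_prod]
            refine Finset.prod_congr rfl fun i _ => ?_
            rw [Complex.norm_def, Complex.norm_def, Complex.normSq_apply, Complex.normSq_apply]
            congr 1
            simp
            ring
          have h2 : ‖g (y * Complex.I)‖ = ‖f (y * Complex.I)‖ := by
            rw [hfG, norm_mul, norm_mul, h1]
          rw [h2, hexpu, mul_comm]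
          exact le_max_left _ _
      have h1 := cw_real hx0 hx1 N
      calc ‖f x‖ = ‖∏ i ∈ Finset.range N, ((x : ℂ) - ((i + 1 : ℕ) : ℂ))‖ * ‖G x‖ := by
            rw [hfG x, norm_mul]
        _ ≤ _ := mul_le_mul_of_nonneg_right h1 (norm_nonneg _)
        _ = Real.exp (-(x * ∑ i ∈ Finset.range N, (1 / (i + 1) : ℝ))) * ‖g x‖ := by
            rw [mul_assoc, ← norm_mul]
        _ ≤ _ := by gcongr
    have hlim : Filter.Tendsto (fun N : ℕ =>
        Real.exp (-(x * ∑ i ∈ Finset.range N, (1 / (i + 1) : ℝ))) * M) Filter.atTop (nhds 0) := by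
      have h1 := Real.tendsto_sum_range_one_div_nat_succ_atTop.const_mul_atTop hx0
      have h2 := (Real.tendsto_exp_neg_atTop_nhds_zero.comp h1).mul_const M
      simpa using h2
    have := ge_of_tendsto' hlim hN
    exact norm_le_zero_iff.mp this
  have han : AnalyticOnNhd ℂ f Set.univ := hf.differentiableOn.analyticOnNhd isOpen_univ
  have hfreq : ∃ᶠ z in nhdsWithin (((1 / 2 : ℝ)) : ℂ) {((1 / 2 : ℝ) : ℂ)}ᶜ, f z = (fun _ => (0 : ℂ)) z := by
    have ht : Filter.Tendsto (fun x : ℝ => (x : ℂ)) (nhdsWithin (1 / 2) {(1 / 2 : ℝ)}ᶜ)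
        (nhdsWithin (((1 / 2 : ℝ)) : ℂ) {((1 / 2 : ℝ) : ℂ)}ᶜ) := by
      refine tendsto_nhdsWithin_of_tendsto_nhds_of_eventually_within _ ?_ ?_
      · exact Complex.continuous_ofReal.continuousAt.tendsto.mono_left nhdsWithin_le_nhds
      · filter_upwards [self_mem_nhdsWithin] with x hx
        simpa only [Set.mem_compl_iff, Set.mem_singleton_iff, Complex.ofReal_inj] using hx
    apply ht.frequently
    apply Filter.Eventually.frequently
    filter_upwards [nhdsWithin_le_nhds (Ioo_mem_nhds (show (0 : ℝ) < 1 / 2 by norm_num)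
      (show (1 / 2 : ℝ) < 1 by norm_num))] with x hx
    exact hmain x hx.1 hx.2
  have hfin := han.eq_of_frequently_eq (g := fun _ => 0) analyticOnNhd_const hfreq
  intro z
  exact congrFun hfin z
end

section
/- Let q, q̃ ∈ L¹([0,1]) be real potentials with characteristic functions Δ, Δ̃ of the Dirichlet problems -v''+qv=-μ²v and -v''+q̃v=-μ²v on [0,1]. If Δ and Δ̃ have the same zeros (with multiplicity) and neither vanishes at 0, then Δ(μ²) = Δ̃(μ²) for all μ ∈ ℂ. -/
open Set

/-- `u` solves `u'' = (q+a) u + e` on `[0,1]`, with `u'` its derivative. -/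
structure SLSol (q : ℝ → ℝ) (a : ℂ) (e : ℝ → ℂ) (u u' : ℝ → ℂ) : Prop where
  d1 : ∀ x ∈ Icc (0:ℝ) 1, HasDerivAt u (u' x) x
  d2 : ∀ x ∈ Icc (0:ℝ) 1, HasDerivAt u' (((q x : ℂ) + a) * u x + e x) x

structure SLSys (q : ℝ → ℝ) (f f' g g' : ℂ → ℝ → ℂ) (D : ℂ → ℂ) : Prop where
  hf : ∀ z, SLSol q z 0 (f z) (f' z)
  hg : ∀ z, SLSol q z 0 (g z) (g' z)
  f0 : ∀ z, f z 0 = 0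
  f1 : ∀ z, f' z 0 = 1
  g0 : ∀ z, g z 1 = 0
  g1 : ∀ z, g' z 1 = 1
  hD : ∀ z, ∀ x ∈ Icc (0:ℝ) 1, D z = f z x * g' z x - f' z x * g z x
  D0 : D 0 ≠ 0

lemma SLSol.cont {q a e u u'} (h : SLSol q a e u u') : ContinuousOn u (Icc 0 1) :=
  fun x hx => (h.d1 x hx).continuousAt.continuousWithinAt

lemma SLSol.cont' {q a e u u'} (h : SLSol q a e u u') : ContinuousOn u' (Icc 0 1) :=
  fun x hx => (h.d2 x hx).continuousAt.continuousWithinAt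

lemma SLSol.sub {q a b u u' v v'} (h : SLSol q a 0 u u') (k : SLSol q b 0 v v') :
    SLSol q b (fun x => (a - b) * u x) (fun x => u x - v x) (fun x => u' x - v' x) := by
  refine ⟨fun x hx => (h.d1 x hx).sub (k.d1 x hx), fun x hx => ?_⟩
  refine HasDerivAt.congr_deriv ((h.d2 x hx).sub (k.d2 x hx)) ?_
  simp only [Pi.zero_apply]; ring

lemma SLSol.cmul {q a u u'} (c : ℂ) (h : SLSol q a 0 u u') :
    SLSol q a 0 (fun x => c * u x) (fun x => c * u' x) := by
  refine ⟨fun x hx => (h.d1 x hx).const_mul c, fun x hx => ?_⟩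
  refine HasDerivAt.congr_deriv ((h.d2 x hx).const_mul c) ?_
  simp only [Pi.zero_apply]; ring

lemma SLSol.star {q a u u'} (h : SLSol q a 0 u u') :
    SLSol q (star a) 0 (fun x => star (u x)) (fun x => star (u' x)) := by
  refine ⟨fun x hx => (h.d1 x hx).star, fun x hx => ?_⟩
  refine HasDerivAt.congr_deriv ((h.d2 x hx).star) ?_
  simp

lemma SLSol.wronsk {q a b u u' v v'} (h : SLSol q a 0 u u') (k : SLSol q b 0 v v') :
    (b - a) * ∫ x in (0:ℝ)..1, u x * v x =
      (u 1 * v' 1 - u' 1 * v 1) - (u 0 * v' 0 - u' 0 * v 0) := by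
  have hc : ContinuousOn (fun x => (b - a) * (u x * v x)) (uIcc 0 1) := by
    rw [uIcc_of_le zero_le_one]
    exact continuousOn_const.mul (h.cont.mul k.cont)
  rw [← intervalIntegral.integral_const_mul]
  refine intervalIntegral.integral_eq_sub_of_hasDerivAt
    (f := fun x => u x * v' x - u' x * v x) ?_ hc.intervalIntegrable
  intro x hx
  rw [uIcc_of_le zero_le_one] at hx
  refine HasDerivAt.congr_deriv (((h.d1 x hx).mul (k.d2 x hx)).sub ((h.d2 x hx).mul (k.d1 x hx))) ?_
  simp only [Pi.zero_apply]; ring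

lemma SLSys.bound {q f f' g g' D} (S : SLSys q f f' g g' D) (R : ℝ) :
    ∃ C : ℝ, 0 ≤ C ∧ ∀ a : ℂ, ‖a‖ ≤ R → ∀ u u' e, ∀ ε δ : ℝ, 0 ≤ ε → 0 ≤ δ → SLSol q a e u u' →
      (∀ x ∈ Icc (0:ℝ) 1, ‖e x‖ ≤ ε) → ‖u 0‖ ≤ δ → ‖u' 0‖ ≤ δ →
      ∀ x ∈ Icc (0:ℝ) 1, ‖u x‖ ≤ C * (δ + ε) := by
  obtain ⟨K1, hK1⟩ := isCompact_Icc.exists_bound_of_continuousOn (S.hf 0).cont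
  obtain ⟨K2, hK2⟩ := isCompact_Icc.exists_bound_of_continuousOn (S.hg 0).cont
  obtain ⟨K3, hK3⟩ := isCompact_Icc.exists_bound_of_continuousOn (S.hf 0).cont'
  obtain ⟨K4, hK4⟩ := isCompact_Icc.exists_bound_of_continuousOn (S.hg 0).cont'
  obtain ⟨K, hK0, h1, h2, h3, h4⟩ : ∃ K : ℝ, 0 ≤ K ∧ K1 ≤ K ∧ K2 ≤ K ∧ K3 ≤ K ∧ K4 ≤ K :=
    ⟨max 0 (max (max K1 K2) (max K3 K4)), by simp, by simp, by simp, by simp, by simp⟩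
  set d := ‖D 0‖ with hd
  have hd0 : 0 < d := norm_pos_iff.2 S.D0
  set R' := max R 0
  have hR' : 0 ≤ R' := le_max_right _ _
  set k := R' * (2 * K / d) * K + 1 with hk
  have hk1 : 1 ≤ k := by rw [hk]; have : 0 ≤ R' * (2 * K / d) * K := by positivity
                         linarith
  refine ⟨(2 * K / d) * (2 * K * Real.exp k), by positivity, ?_⟩
  intro a ha u u' e ε δ hε hδ hu he hu0 hu0'
  have ha' : ‖a‖ ≤ R' := ha.trans (le_max_left _ _)
  let A : ℝ → ℂ := fun x => u x * g' 0 x - u' x * g 0 x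
  let B : ℝ → ℂ := fun x => u x * f' 0 x - u' x * f 0 x
  let P : ℝ → ℂ × ℂ := fun x => (A x, B x)
  have hA : ∀ x ∈ Icc (0:ℝ) 1, HasDerivAt A (-((a * u x + e x) * g 0 x)) x := by
    intro x hx
    refine HasDerivAt.congr_deriv (((hu.d1 x hx).mul ((S.hg 0).d2 x hx)).sub ((hu.d2 x hx).mul ((S.hg 0).d1 x hx))) ?_
    simp only [Pi.zero_apply]; ring
  have hB : ∀ x ∈ Icc (0:ℝ) 1, HasDerivAt B (-((a * u x + e x) * f 0 x)) x := by
    intro x hx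
    refine HasDerivAt.congr_deriv (((hu.d1 x hx).mul ((S.hf 0).d2 x hx)).sub ((hu.d2 x hx).mul ((S.hf 0).d1 x hx))) ?_
    simp only [Pi.zero_apply]; ring
  have hP : ∀ x ∈ Icc (0:ℝ) 1, HasDerivAt P (-((a * u x + e x) * g 0 x), -((a * u x + e x) * f 0 x)) x :=
    fun x hx => (hA x hx).prodMk (hB x hx)
  have huP : ∀ x ∈ Icc (0:ℝ) 1, ‖u x‖ ≤ 2 * K / d * ‖P x‖ := by
    intro x hx
    have e1 : u x * D 0 = A x * f 0 x - B x * g 0 x := by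
      rw [S.hD 0 x hx]; simp only [A, B]; ring
    have e2 : ‖u x‖ * d ≤ ‖P x‖ * K + ‖P x‖ * K := by
      rw [hd, ← norm_mul, e1]
      refine (norm_sub_le _ _).trans ?_
      rw [norm_mul, norm_mul]
      have := norm_fst_le (P x)
      have := norm_snd_le (P x)
      have := (hK1 x hx).trans h1
      have := (hK2 x hx).trans h2
      gcongr
    rw [div_mul_eq_mul_div, le_div_iff₀ hd0]
    linarith
  have hP0 : ‖P 0‖ ≤ 2 * K * δ := by
    have h0 : (0:ℝ) ∈ Icc (0:ℝ) 1 := by simp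
    have b1 := (hK1 0 h0).trans h1
    have b2 := (hK2 0 h0).trans h2
    have b3 := (hK3 0 h0).trans h3
    have b4 := (hK4 0 h0).trans h4
    refine norm_prod_le_iff.2 ⟨?_, ?_⟩
    · refine (norm_sub_le _ _).trans ?_
      rw [norm_mul, norm_mul]
      have := mul_le_mul hu0 b4 (norm_nonneg _) hδ
      have := mul_le_mul hu0' b2 (norm_nonneg _) hδ
      linarith
    · refine (norm_sub_le _ _).trans ?_
      rw [norm_mul, norm_mul]
      have := mul_le_mul hu0 b3 (norm_nonneg _) hδ
      have := mul_le_mul hu0' b1 (norm_nonneg _) hδ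
      linarith
  have key : ∀ x ∈ Icc (0:ℝ) 1, ∀ w : ℂ, ‖w‖ ≤ K → ‖-((a * u x + e x) * w)‖ ≤ k * ‖P x‖ + 2 * K * ε := by
    intro x hx w hw
    have i1 : ‖a * u x + e x‖ ≤ R' * (2 * K / d * ‖P x‖) + ε := by
      refine (norm_add_le _ _).trans ?_
      rw [norm_mul]
      have := huP x hx
      have := he x hx
      gcongr
    rw [norm_neg, norm_mul]
    have i2 := mul_le_mul i1 hw (norm_nonneg _) (by positivity)
    refine i2.trans ?_
    have : 0 ≤ ‖P x‖ := norm_nonneg _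
    have : 0 ≤ K * ε := by positivity
    rw [hk]; nlinarith
  have G := norm_le_gronwallBound_of_norm_deriv_right_le (f := P)
    (f' := fun x => (-((a * u x + e x) * g 0 x), -((a * u x + e x) * f 0 x)))
    (δ := 2 * K * δ) (K := k) (ε := 2 * K * ε) (a := 0) (b := 1)
    (fun x hx => (hP x hx).continuousAt.continuousWithinAt)
    (fun x hx => (hP x (Ico_subset_Icc_self hx)).hasDerivWithinAt) hP0
    (fun x hx => by
      have hx := Ico_subset_Icc_self hx
      exact norm_prod_le_iff.2 ⟨key x hx _ ((hK2 x hx).trans h2), key x hx _ ((hK1 x hx).trans h1)⟩)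
  intro x hx
  have Gx := G x hx
  rw [gronwallBound_of_K_ne_0 (by linarith)] at Gx
  have hPx : ‖P x‖ ≤ 2 * K * Real.exp k * (δ + ε) := by
    refine Gx.trans ?_
    have e1 : Real.exp (k * (x - 0)) ≤ Real.exp k := by
      apply Real.exp_le_exp.2
      have := hx.2
      nlinarith
    have e2 : 2 * K * ε / k ≤ 2 * K * ε := div_le_self (by positivity) hk1
    have e3 : 0 ≤ 2 * K * ε / k := by positivity
    have e4 := Real.exp_pos k
    calc _ ≤ 2 * K * δ * Real.exp k + 2 * K * ε * Real.exp k := by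
            apply add_le_add
            · gcongr
            · refine (mul_le_mul_of_nonneg_left (b := Real.exp (k * (x-0)) - 1) (c := Real.exp k) (by linarith) e3).trans ?_
              gcongr
      _ = _ := by ring
  calc ‖u x‖ ≤ 2 * K / d * ‖P x‖ := huP x hx
    _ ≤ 2 * K / d * (2 * K * Real.exp k * (δ + ε)) := by gcongr
    _ = _ := by ring

lemma SLSys.unique {q f f' g g' D} (S : SLSys q f f' g g' D) {a u u' v v'}
    (hu : SLSol q a 0 u u') (hv : SLSol q a 0 v v') (h0 : u 0 = v 0) (h1 : u' 0 = v' 0) :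
    ∀ x ∈ Icc (0:ℝ) 1, u x = v x := by
  obtain ⟨C, -, hC⟩ := S.bound ‖a‖
  intro x hx
  have := hC a le_rfl _ _ _ 0 0 le_rfl le_rfl (hu.sub hv) (by simp) (by simp [h0]) (by simp [h1]) x hx
  simp only [add_zero, mul_zero, norm_le_zero_iff] at this
  exact sub_eq_zero.1 this

lemma SLSys.D_one {q f f' g g' D} (S : SLSys q f f' g g' D) (z : ℂ) : D z = f z 1 := by
  rw [S.hD z 1 (by simp), S.g0, S.g1]; ring

lemma SLSys.D_zero {q f f' g g' D} (S : SLSys q f f' g g' D) (z : ℂ) : D z = - g z 0 := by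
  rw [S.hD z 0 (by simp), S.f0, S.f1]; ring

lemma SLSys.D_sub {q f f' g g' D} (S : SLSys q f f' g g' D) (z w : ℂ) :
    D z - D w = (w - z) * ∫ x in (0:ℝ)..1, f z x * g w x := by
  rw [(S.hf z).wronsk (S.hg w), S.D_one z, S.D_zero w, S.g0, S.g1, S.f0, S.f1]; ring

lemma SLSys.hasDerivAt {q f f' g g' D} (S : SLSys q f f' g g' D) (w : ℂ) :
    HasDerivAt D (-∫ x in (0:ℝ)..1, f w x * g w x) w := by
  rw [hasDerivAt_iff_tendsto_slope]
  obtain ⟨C, hC0, hC⟩ := S.bound (‖w‖ + 1)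
  obtain ⟨M, hM⟩ := isCompact_Icc.exists_bound_of_continuousOn (S.hg w).cont
  have hM0 : 0 ≤ M := (norm_nonneg _).trans (hM 0 (by simp))
  have hint : ∀ z, IntervalIntegrable (fun x => f z x * g w x) MeasureTheory.volume 0 1 := by
    intro z
    apply ContinuousOn.intervalIntegrable
    rw [uIcc_of_le zero_le_one]
    exact (S.hf z).cont.mul (S.hg w).cont
  have hb : ∀ z : ℂ, ‖z‖ ≤ ‖w‖ + 1 → ‖(∫ x in (0:ℝ)..1, f z x * g w x) -
      ∫ x in (0:ℝ)..1, f w x * g w x‖ ≤ C * (‖z - w‖ * C) * M := by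
    intro z hz
    rw [← intervalIntegral.integral_sub (hint z) (hint w)]
    have := intervalIntegral.norm_integral_le_of_norm_le_const
      (f := fun x => f z x * g w x - f w x * g w x) (a := 0) (b := 1) (C := C * (‖z - w‖ * C) * M) ?_
    · simpa using this
    intro x hx
    rw [uIoc_of_le zero_le_one] at hx
    have hx := Ioc_subset_Icc_self hx
    rw [← sub_mul, norm_mul]
    have h1 : ∀ x ∈ Icc (0:ℝ) 1, ‖f z x‖ ≤ C := by
      have := hC z hz _ _ 0 0 1 le_rfl zero_le_one (S.hf z) (by simp) (by simp [S.f0]) (by simp [S.f1])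
      simpa using this
    have h2 := hC w (by linarith) _ _ _ (‖z - w‖ * C) 0 (by positivity) le_rfl ((S.hf z).sub (S.hf w))
      (fun x hx => by rw [norm_mul]; have := h1 x hx; gcongr) (by simp [S.f0]) (by simp [S.f1]) x hx
    rw [zero_add] at h2
    have := hM x hx
    gcongr
  have ht : Filter.Tendsto (fun z => ∫ x in (0:ℝ)..1, f z x * g w x) (nhds w)
      (nhds (∫ x in (0:ℝ)..1, f w x * g w x)) := by
    rw [tendsto_iff_norm_sub_tendsto_zero]
    have hlim : Filter.Tendsto (fun z : ℂ => C * (‖z - w‖ * C) * M) (nhds w) (nhds 0) := by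
      have : Continuous (fun z : ℂ => C * (‖z - w‖ * C) * M) := by fun_prop
      simpa using this.tendsto w
    refine squeeze_zero' (Filter.Eventually.of_forall fun _ => norm_nonneg _) ?_ hlim
    filter_upwards [Metric.ball_mem_nhds w one_pos] with z hz
    apply hb
    rw [mem_ball_iff_norm] at hz
    have := norm_add_le (z - w) w
    simp only [sub_add_cancel] at this
    linarith
  refine ((ht.neg).mono_left nhdsWithin_le_nhds).congr' ?_
  filter_upwards [self_mem_nhdsWithin] with z hz
  have hzw : z - w ≠ 0 := sub_ne_zero.2 hz
  rw [slope_def_field, S.D_sub, eq_div_iff hzw]; ring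

lemma SLSys.int_ne {q f f' g g' D} (S : SLSys q f f' g g' D) {w : ℂ} (hw : D w = 0) :
    ∫ x in (0:ℝ)..1, f w x * g w x ≠ 0 := by
  have hpos : 0 < ∫ x in (0:ℝ)..1, ‖f w x‖ ^ 2 := by
    apply intervalIntegral.integral_pos zero_lt_one
    · exact (S.hf w).cont.norm.pow 2
    · intro x _; positivity
    · by_contra hcon
      have hz : ∀ x ∈ Icc (0:ℝ) 1, f w x = 0 := by
        intro x hx
        by_contra hne
        exact hcon ⟨x, hx, by have := norm_pos_iff.2 hne; positivity⟩
      have h0 : (0:ℝ) ∈ Icc (0:ℝ) 1 := by simp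
      have d1 := ((S.hf w).d1 0 h0).hasDerivWithinAt (s := Icc 0 1)
      have d2 : HasDerivWithinAt (f w) 0 (Icc 0 1) 0 :=
        (hasDerivWithinAt_const (0:ℝ) (Icc (0:ℝ) 1) (0:ℂ)).congr hz (hz 0 h0)
      have := UniqueDiffWithinAt.eq_deriv _ (uniqueDiffOn_Icc zero_lt_one 0 h0) d1 d2
      rw [S.f1] at this
      exact one_ne_zero this
  have hff : ∫ x in (0:ℝ)..1, f w x * star (f w x) ≠ 0 := by
    have : ∫ x in (0:ℝ)..1, f w x * star (f w x) = ((∫ x in (0:ℝ)..1, ‖f w x‖ ^ 2 : ℝ) : ℂ) := by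
      rw [← intervalIntegral.integral_ofReal]
      congr 1; ext x
      push_cast
      exact Complex.mul_conj' _
    rw [this]
    exact_mod_cast hpos.ne'
  have hf1 : f w 1 = 0 := by rw [← S.D_one, hw]
  have hreal : star w = w := by
    have := (S.hf w).wronsk (S.hf w).star
    rw [hf1, S.f0, S.f1] at this
    simp only [star_zero, mul_zero, zero_mul, sub_zero, mul_eq_zero] at this
    rcases this with h | h
    · exact sub_eq_zero.1 h
    · exact absurd h hff
  have hst : SLSol q w 0 (fun x => star (f w x)) (fun x => star (f' w x)) := by
    have := (S.hf w).star
    rwa [hreal] at this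
  have hs := S.unique hst (S.hf w) (by simp [S.f0]) (by simp [S.f1])
  have hg0 : g w 0 = 0 := by have := S.D_zero w; rw [hw] at this; simpa using this.symm
  have hg := S.unique (S.hg w) ((S.hf w).cmul (g' w 0)) (by simp [S.f0, hg0]) (by simp [S.f1])
  have hc : g' w 0 ≠ 0 := by
    intro h0
    have hz : ∀ x ∈ Icc (0:ℝ) 1, g w x = 0 := by
      intro x hx; rw [hg x hx, h0, zero_mul]
    have h1 : (1:ℝ) ∈ Icc (0:ℝ) 1 := by simp
    have d1 := ((S.hg w).d1 1 h1).hasDerivWithinAt (s := Icc 0 1)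
    have d2 : HasDerivWithinAt (g w) 0 (Icc 0 1) 1 :=
      (hasDerivWithinAt_const (1:ℝ) (Icc (0:ℝ) 1) (0:ℂ)).congr hz (hz 1 h1)
    have := UniqueDiffWithinAt.eq_deriv _ (uniqueDiffOn_Icc zero_lt_one 1 h1) d1 d2
    rw [S.g1] at this
    exact one_ne_zero this
  have : ∫ x in (0:ℝ)..1, f w x * g w x = g' w 0 * ∫ x in (0:ℝ)..1, f w x * star (f w x) := by
    rw [← intervalIntegral.integral_const_mul]
    apply intervalIntegral.integral_congr
    intro x hx
    rw [uIcc_of_le zero_le_one] at hx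
    simp only
    rw [hg x hx, hs x hx]; ring
  rw [this]
  exact mul_ne_zero hc hff

lemma norm_sinh_le (w : ℂ) : ‖Complex.sinh w‖ ≤ Real.exp |w.re| := by
  rw [Complex.sinh, norm_div]
  have h1 : ‖Complex.exp w - Complex.exp (-w)‖ ≤ Real.exp |w.re| + Real.exp |w.re| := by
    refine (norm_sub_le _ _).trans ?_
    rw [Complex.norm_exp, Complex.norm_exp]
    apply add_le_add <;> apply Real.exp_le_exp.2
    · exact le_abs_self _
    · rw [Complex.neg_re]; exact neg_le_abs _
  rw [div_le_iff₀ (by simp)]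
  simp only [Complex.norm_ofNat]
  linarith

lemma SLSys.asymp {q f f' g g' D} (S : SLSys q f f' g g' D)
    (hq : MeasureTheory.IntegrableOn q (Icc (0:ℝ) 1)) :
    ∃ C : ℝ, 0 ≤ C ∧ ∀ μ : ℂ, C + 1 ≤ ‖μ‖ →
      ‖D (μ ^ 2) - Complex.sinh μ / μ‖ ≤ C * Real.exp |μ.re| / ‖μ‖ ^ 2 := by
  set I := ∫ t in (0:ℝ)..1, |q t| with hI
  have hI0 : 0 ≤ I := intervalIntegral.integral_nonneg zero_le_one (fun _ _ => abs_nonneg _)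
  refine ⟨2 * I, by positivity, fun μ hμ => ?_⟩
  have hm : 0 < ‖μ‖ := by linarith
  have hμ0 : μ ≠ 0 := norm_pos_iff.1 hm
  set σ := |μ.re| with hσ
  have hS := S.hf (μ ^ 2)
  set φ := f (μ ^ 2) with hφ
  set φ' := f' (μ ^ 2) with hφ'
  have hcw : ContinuousOn (fun x => ‖φ x‖ * Real.exp (-(σ * x))) (Icc 0 1) :=
    hS.cont.norm.mul (by fun_prop)
  obtain ⟨x0, hx0, hmax⟩ := isCompact_Icc.exists_isMaxOn (nonempty_Icc.2 zero_le_one) hcw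
  set M := ‖φ x0‖ * Real.exp (-(σ * x0)) with hM
  have hM0 : 0 ≤ M := by positivity
  have hφM : ∀ x ∈ Icc (0:ℝ) 1, ‖φ x‖ ≤ M * Real.exp (σ * x) := by
    intro x hx
    have : ‖φ x‖ * Real.exp (-(σ * x)) ≤ M := hmax hx
    rwa [Real.exp_neg, ← div_eq_mul_inv, div_le_iff₀ (Real.exp_pos _)] at this
  have hsub : ∀ x ∈ Icc (0:ℝ) 1, Icc 0 x ⊆ Icc (0:ℝ) 1 := fun x hx => Icc_subset_Icc_right hx.2
  have habs : ∀ x ∈ Icc (0:ℝ) 1, IntervalIntegrable (fun t => |q t|) MeasureTheory.volume 0 x := by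
    intro x hx
    rw [intervalIntegrable_iff_integrableOn_Icc_of_le hx.1]
    exact (hq.mono_set (hsub x hx)).abs
  have hvol : ∀ x ∈ Icc (0:ℝ) 1, ‖φ x - Complex.sinh (μ * x) / μ‖ ≤
      Real.exp (σ * x) * M / ‖μ‖ * I := by
    intro x hx
    have hint : IntervalIntegrable
        (fun t : ℝ => (q t : ℂ) * (Complex.sinh (μ * (x - t)) / μ * φ t)) MeasureTheory.volume 0 x := by
      rw [intervalIntegrable_iff_integrableOn_Icc_of_le hx.1]
      have h1 : MeasureTheory.IntegrableOn (fun t => (q t : ℂ)) (Icc 0 x) :=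
        (hq.mono_set (hsub x hx)).ofReal
      refine h1.mul_continuousOn ?_ isCompact_Icc
      refine ContinuousOn.mul ?_ (hS.cont.mono (hsub x hx))
      fun_prop
    have hFTC := intervalIntegral.integral_eq_sub_of_hasDerivAt
      (f := fun t : ℝ => Complex.sinh (μ * (x - t)) / μ * φ' t + Complex.cosh (μ * (x - t)) * φ t)
      (f' := fun t : ℝ => (q t : ℂ) * (Complex.sinh (μ * (x - t)) / μ * φ t)) (a := 0) (b := x) ?_ hint
    · have e0 : φ 0 = 0 := S.f0 _
      have e1 : φ' 0 = 1 := S.f1 _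
      simp only [sub_self, mul_zero, Complex.sinh_zero, Complex.cosh_zero, zero_div, zero_mul,
        zero_add, one_mul, e0, e1, Complex.ofReal_zero, sub_zero, mul_one, add_zero] at hFTC
      rw [← hFTC]
      have hI' : ∫ t in (0:ℝ)..x, Real.exp (σ * x) * M / ‖μ‖ * |q t| ≤ Real.exp (σ * x) * M / ‖μ‖ * I := by
        rw [intervalIntegral.integral_const_mul]
        gcongr
        rw [hI]
        apply intervalIntegral.integral_mono_interval le_rfl hx.1 hx.2
        · exact Filter.Eventually.of_forall fun _ => abs_nonneg _
        · exact habs 1 (by simp)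
      refine le_trans ?_ hI'
      refine intervalIntegral.norm_integral_le_of_norm_le hx.1 ?_ ((habs x hx).const_mul _)
      refine Filter.Eventually.of_forall fun t ht => ?_
      have htx : t ∈ Icc 0 x := Ioc_subset_Icc_self ht
      have b1 : ‖Complex.sinh (μ * (x - t))‖ ≤ Real.exp (σ * (x - t)) := by
        refine (norm_sinh_le _).trans (Real.exp_le_exp.2 ?_)
        have : (μ * (x - t)).re = μ.re * (x - t) := by
          rw [← Complex.ofReal_sub, Complex.re_mul_ofReal]
        rw [this, abs_mul, abs_of_nonneg (sub_nonneg.2 htx.2)]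
      have b2 := hφM t (hsub x hx htx)
      rw [norm_mul, norm_mul, norm_div, Complex.norm_real, Real.norm_eq_abs]
      calc |q t| * (‖Complex.sinh (μ * (x - t))‖ / ‖μ‖ * ‖φ t‖)
          ≤ |q t| * (Real.exp (σ * (x - t)) / ‖μ‖ * (M * Real.exp (σ * t))) := by gcongr
        _ = (Real.exp (σ * (x - t)) * Real.exp (σ * t)) * M / ‖μ‖ * |q t| := by ring
        _ = _ := by rw [← Real.exp_add]; congr 4; ring
    · intro t ht
      rw [uIcc_of_le hx.1] at ht
      have ht := hsub x hx ht
      have hl : HasDerivAt (fun t : ℝ => μ * ((x:ℂ) - t)) (-μ) t := by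
        have := ((Complex.ofRealCLM.hasDerivAt (x := t)).const_sub (x:ℂ)).const_mul μ
        simpa using this
      have hsn := (Complex.hasDerivAt_sinh (μ * (x - t))).comp t hl
      have hch := (Complex.hasDerivAt_cosh (μ * (x - t))).comp t hl
      refine HasDerivAt.congr_deriv (((hsn.div_const μ).mul (hS.d2 t ht)).add (hch.mul (hS.d1 t ht))) ?_
      simp only [Function.comp_apply, Pi.zero_apply]
      field_simp
      ring
  have hMle : M ≤ 2 / ‖μ‖ := by
    have h1 := hvol x0 hx0
    have h2 : ‖Complex.sinh (μ * x0) / μ‖ ≤ Real.exp (σ * x0) / ‖μ‖ := by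
      rw [norm_div]
      gcongr
      refine (norm_sinh_le _).trans (Real.exp_le_exp.2 ?_)
      rw [Complex.re_mul_ofReal, abs_mul, abs_of_nonneg hx0.1]
    have h3 : ‖φ x0‖ ≤ Real.exp (σ * x0) * ((1 + M * I) / ‖μ‖) := by
      have := norm_add_le (φ x0 - Complex.sinh (μ * x0) / μ) (Complex.sinh (μ * x0) / μ)
      rw [sub_add_cancel] at this
      calc _ ≤ Real.exp (σ * x0) * M / ‖μ‖ * I + Real.exp (σ * x0) / ‖μ‖ := by linarith
        _ = _ := by ring
    have h4 : M ≤ (1 + M * I) / ‖μ‖ := by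
      have h5 : M = ‖φ x0‖ / Real.exp (σ * x0) := by rw [hM, Real.exp_neg, ← div_eq_mul_inv]
      refine h5.le.trans ?_
      rw [div_le_iff₀ (Real.exp_pos _)]
      linarith
    rw [le_div_iff₀ hm] at h4 ⊢
    nlinarith
  have := hvol 1 (by simp)
  rw [S.D_one]
  simp only [Complex.ofReal_one, mul_one] at this
  refine this.trans ?_
  calc Real.exp σ * M / ‖μ‖ * I ≤ Real.exp σ * (2 / ‖μ‖) / ‖μ‖ * I := by gcongr
    _ = _ := by field_simp

lemma abs_sin_half (n : ℕ) (b : ℝ) (hb0 : 0 ≤ b) (h1 : b ≤ (n + 1/2) * Real.pi)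
    (h2 : (n + 1/2) * Real.pi - b ≤ 1) : 1/2 ≤ |Real.sin b| := by
  set δ := (n + 1/2) * Real.pi - b with hδ
  have hb : b = (Real.pi / 2 - δ) + n * Real.pi := by rw [hδ]; ring
  have : |Real.sin b| = |Real.cos δ| := by
    rw [hb, Real.sin_add_nat_mul_pi, Real.sin_pi_div_two_sub, abs_mul]
    simp
  rw [this]
  have := Real.one_sub_sq_div_two_le_cos (x := δ)
  refine le_trans ?_ (le_abs_self _)
  have : 0 ≤ δ := by linarith
  nlinarith

lemma sinh_lower (n : ℕ) (hn : 1 ≤ n) (μ : ℂ) (hμ : ‖μ‖ = (n + 1/2) * Real.pi) :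
    Real.exp |μ.re| / 8 ≤ ‖Complex.sinh μ‖ := by
  have hpi := Real.pi_gt_three
  have hn' : (1:ℝ) ≤ n := by exact_mod_cast hn
  rcases le_total 1 |μ.re| with h | h
  · have h1 : Real.exp |μ.re| - Real.exp (-|μ.re|) ≤ ‖Complex.exp μ - Complex.exp (-μ)‖ := by
      rcases abs_cases μ.re with ⟨e, _⟩ | ⟨e, _⟩
      · have := norm_sub_norm_le (Complex.exp μ) (Complex.exp (-μ))
        rw [Complex.norm_exp, Complex.norm_exp, Complex.neg_re] at this
        rw [e]; exact this
      · have := norm_sub_norm_le (Complex.exp (-μ)) (Complex.exp μ)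
        rw [Complex.norm_exp, Complex.norm_exp, Complex.neg_re, norm_sub_rev] at this
        rw [e, neg_neg]; exact this
    rw [Complex.sinh, norm_div]
    simp only [Complex.norm_ofNat]
    have h2 : Real.exp (-|μ.re|) ≤ 1/2 := by
      rw [Real.exp_neg]
      have := Real.add_one_le_exp |μ.re|
      rw [inv_eq_one_div]
      apply one_div_le_one_div_of_le <;> linarith
    have := Real.add_one_le_exp |μ.re|
    linarith
  · have h1 : |Real.sin μ.im| ≤ ‖Complex.sinh μ‖ := by
      have e : (Complex.sinh μ).im = Real.cosh μ.re * Real.sin μ.im := by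
        conv_lhs => rw [← Complex.re_add_im μ]
        rw [Complex.sinh_add, Complex.sinh_mul_I, Complex.cosh_mul_I]
        rw [← Complex.ofReal_sinh, ← Complex.ofReal_cosh, ← Complex.ofReal_cos, ← Complex.ofReal_sin]
        simp [-Complex.ofReal_sinh, -Complex.ofReal_cosh, -Complex.ofReal_cos, -Complex.ofReal_sin]
      refine le_trans ?_ (Complex.abs_im_le_norm _)
      rw [e, abs_mul, abs_of_pos (Real.cosh_pos _)]
      have := Real.one_le_cosh μ.re
      nlinarith [abs_nonneg (Real.sin μ.im)]
    have h2 : 1/2 ≤ |Real.sin (|μ.im|)| := by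
      have hb := Complex.abs_im_le_norm μ
      apply abs_sin_half n _ (abs_nonneg _)
      · rw [← hμ]; exact hb
      · rw [← hμ]
        have := Complex.norm_le_abs_re_add_abs_im μ
        linarith
    have h3 : |Real.sin (|μ.im|)| = |Real.sin μ.im| := by
      rcases abs_cases μ.im with ⟨e, _⟩ | ⟨e, _⟩ <;> rw [e]
      rw [Real.sin_neg, abs_neg]
    have h4 : Real.exp |μ.re| ≤ 4 := by
      have := Real.exp_one_lt_d9
      have := Real.exp_le_exp.2 h
      linarith
    linarith

open Classical in
lemma quot_entire {h E : ℂ → ℂ} (hh : Differentiable ℂ h) (hE : Differentiable ℂ E)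
    (hz : ∀ z, E z = 0 → h z = 0) (hs : ∀ z, E z = 0 → deriv E z ≠ 0) :
    Differentiable ℂ (fun z => if E z = 0 then deriv h z / deriv E z else h z / E z) := by
  intro w
  by_cases hw : E w = 0
  · have d1 : DifferentiableAt ℂ (dslope h w) w :=
      ((Complex.differentiableOn_dslope Filter.univ_mem).2 hh.differentiableOn).differentiableAt
        Filter.univ_mem
    have d2 : DifferentiableAt ℂ (dslope E w) w :=
      ((Complex.differentiableOn_dslope Filter.univ_mem).2 hE.differentiableOn).differentiableAt
        Filter.univ_mem
    have hne : dslope E w w ≠ 0 := by rw [dslope_same]; exact hs w hw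
    refine (d1.div d2 hne).congr_of_eventuallyEq ?_
    filter_upwards [d2.continuousAt.eventually_ne hne] with z hzne
    by_cases hzw : z = w
    · subst hzw
      simp [hw]
    · have hzw' : z - w ≠ 0 := sub_ne_zero.2 hzw
      rw [Pi.div_apply]
      rw [dslope_of_ne _ hzw, slope_def_field, hw, sub_zero] at hzne
      have hEz : E z ≠ 0 := fun h0 => hzne (by rw [h0, zero_div])
      rw [if_neg hEz, dslope_of_ne _ hzw, dslope_of_ne _ hzw, slope_def_field, slope_def_field,
        hw, hz w hw, sub_zero, sub_zero]
      field_simp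
  · refine ((hh w).div (hE w) hw).congr_of_eventuallyEq ?_
    filter_upwards [(hE w).continuousAt.eventually_ne hw] with z hz
    rw [if_neg hz]; rfl

lemma SLSys.eq {q f f' g g' D r p p' k k' E} (S : SLSys q f f' g g' D) (T : SLSys r p p' k k' E)
    (hq : MeasureTheory.IntegrableOn q (Icc (0:ℝ) 1))
    (hr : MeasureTheory.IntegrableOn r (Icc (0:ℝ) 1))
    (hsame : ∀ z, D z = 0 ↔ E z = 0) : ∀ z, D z = E z := by
  classical
  have hD : Differentiable ℂ D := fun z => (S.hasDerivAt z).differentiableAt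
  have hE : Differentiable ℂ E := fun z => (T.hasDerivAt z).differentiableAt
  have hG := quot_entire (h := fun z => D z - E z) (hD.sub hE) hE
    (fun z hz => by rw [(hsame z).2 hz, hz, sub_zero])
    (fun z hz => by rw [(T.hasDerivAt z).deriv]; exact neg_ne_zero.2 (T.int_ne hz))
  set G : ℂ → ℂ := fun z => if E z = 0 then deriv (fun z => D z - E z) z / deriv E z
    else (D z - E z) / E z with hGdef
  obtain ⟨C1, hC1, h1⟩ := S.asymp hq
  obtain ⟨C2, hC2, h2⟩ := T.asymp hr
  set ρ : ℕ → ℝ := fun n => (n + 1/2) * Real.pi with hρ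
  have hρt : Filter.Tendsto ρ Filter.atTop Filter.atTop := by
    apply Filter.Tendsto.atTop_mul_const Real.pi_pos
    exact Filter.tendsto_atTop_add_const_right _ _ tendsto_natCast_atTop_atTop
  have hGzero : ∀ z, G z = 0 := by
    intro z
    have hlim : Filter.Tendsto (fun n => 16 * (C1 + C2) / ρ n) Filter.atTop (nhds 0) :=
      hρt.const_div_atTop _
    have hb : ∀ᶠ n in Filter.atTop, ‖G z‖ ≤ 16 * (C1 + C2) / ρ n := by
      filter_upwards [Filter.eventually_ge_atTop 1, hρt.eventually_ge_atTop (C1 + 1),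
        hρt.eventually_ge_atTop (16 * C2 + 1), hρt.eventually_ge_atTop (‖z‖ + 1)] with n n1 n2 n3 n4
      have hρ0 : 0 < ρ n := by linarith
      refine Complex.norm_le_of_forall_mem_frontier_norm_le (U := Metric.ball 0 (ρ n ^ 2))
        Metric.isBounded_ball hG.diffContOnCl ?_ (subset_closure ?_)
      · intro w hw
        rw [frontier_ball _ (by positivity), mem_sphere_zero_iff_norm] at hw
        obtain ⟨μ, hμ⟩ : ∃ μ : ℂ, μ ^ 2 = w := ⟨w ^ ((2:ℕ):ℂ)⁻¹, Complex.cpow_nat_inv_pow w two_ne_zero⟩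
        have hμn : ‖μ‖ = ρ n := by
          rw [← hμ, norm_pow] at hw
          exact (pow_left_inj₀ (norm_nonneg _) hρ0.le two_ne_zero).1 hw
        have a1 := h1 μ (by rw [hμn]; exact n2)
        have a2 := h2 μ (by rw [hμn]; linarith)
        have a3 := sinh_lower n n1 μ hμn
        rw [hμ, hμn] at a1 a2
        set X := Real.exp |μ.re|
        have hX : 0 < X := Real.exp_pos _
        have a4 : X / 8 / ρ n ≤ ‖Complex.sinh μ / μ‖ := by
          rw [norm_div, hμn]; gcongr
        have a5 : C2 * X / ρ n ^ 2 ≤ X / 16 / ρ n := by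
          rw [div_le_div_iff₀ (by positivity) hρ0]
          have : 0 ≤ X * ρ n := by positivity
          nlinarith
        have a6 : X / 16 / ρ n ≤ ‖E w‖ := by
          have := norm_sub_norm_le (Complex.sinh μ / μ) (Complex.sinh μ / μ - E w)
          rw [sub_sub_cancel, norm_sub_rev _ (E w)] at this
          have e : X / 8 / ρ n = X / 16 / ρ n + X / 16 / ρ n := by ring
          linarith
        have a7 : ‖D w - E w‖ ≤ (C1 + C2) * X / ρ n ^ 2 := by
          have := norm_sub_le (D w - Complex.sinh μ / μ) (E w - Complex.sinh μ / μ)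
          rw [sub_sub_sub_cancel_right] at this
          have e : (C1 + C2) * X / ρ n ^ 2 = C1 * X / ρ n ^ 2 + C2 * X / ρ n ^ 2 := by ring
          linarith
        have hEpos : 0 < ‖E w‖ := lt_of_lt_of_le (by positivity) a6
        have hEw : E w ≠ 0 := norm_pos_iff.1 hEpos
        have : G w = (D w - E w) / E w := by rw [hGdef]; simp only [if_neg hEw]
        rw [this, norm_div]
        calc ‖D w - E w‖ / ‖E w‖ ≤ ((C1 + C2) * X / ρ n ^ 2) / (X / 16 / ρ n) := by gcongr
          _ = _ := by field_simp
      · rw [mem_ball_zero_iff]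
        nlinarith [norm_nonneg z]
    have := ge_of_tendsto hlim hb
    exact norm_le_zero_iff.1 this
  intro z
  by_cases hEz : E z = 0
  · rw [(hsame z).2 hEz, hEz]
  · have := hGzero z
    have e : G z = (D z - E z) / E z := by rw [hGdef]; simp only [if_neg hEz]
    rw [e, div_eq_zero_iff] at this
    exact sub_eq_zero.1 (this.resolve_right hEz)





/-- If the characteristic functions `Δ`, `Δ̃` of two Dirichlet problems
`-v''+qv=-μ²v` and `-v''+q̃v=-μ²v` on `[0,1]` have the same zeros and neither
vanishes at `0`, then `Δ(μ²) = Δ̃(μ²)` for all `μ ∈ ℂ`. -/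
theorem stmt_7
    (q qt : ℝ → ℝ)
    (hq : MeasureTheory.IntegrableOn q (Icc (0:ℝ) 1))
    (hqt : MeasureTheory.IntegrableOn qt (Icc (0:ℝ) 1))
    (s₀ s₁ s₀' s₁' t₀ t₁ t₀' t₁' : ℂ → ℝ → ℂ)
    (hs₀ : ∀ μ : ℂ, ∀ x ∈ Icc (0:ℝ) 1, HasDerivAt (s₀ μ) (s₀' μ x) x)
    (hs₀' : ∀ μ : ℂ, ∀ x ∈ Icc (0:ℝ) 1,
      HasDerivAt (s₀' μ) (((q x : ℂ) + μ ^ 2) * s₀ μ x) x)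
    (hs₁ : ∀ μ : ℂ, ∀ x ∈ Icc (0:ℝ) 1, HasDerivAt (s₁ μ) (s₁' μ x) x)
    (hs₁' : ∀ μ : ℂ, ∀ x ∈ Icc (0:ℝ) 1,
      HasDerivAt (s₁' μ) (((q x : ℂ) + μ ^ 2) * s₁ μ x) x)
    (ht₀ : ∀ μ : ℂ, ∀ x ∈ Icc (0:ℝ) 1, HasDerivAt (t₀ μ) (t₀' μ x) x)
    (ht₀' : ∀ μ : ℂ, ∀ x ∈ Icc (0:ℝ) 1,
      HasDerivAt (t₀' μ) (((qt x : ℂ) + μ ^ 2) * t₀ μ x) x)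
    (ht₁ : ∀ μ : ℂ, ∀ x ∈ Icc (0:ℝ) 1, HasDerivAt (t₁ μ) (t₁' μ x) x)
    (ht₁' : ∀ μ : ℂ, ∀ x ∈ Icc (0:ℝ) 1,
      HasDerivAt (t₁' μ) (((qt x : ℂ) + μ ^ 2) * t₁ μ x) x)
    (h₀0 : ∀ μ : ℂ, s₀ μ 0 = 0) (h₀1 : ∀ μ : ℂ, s₀' μ 0 = 1)
    (h₁0 : ∀ μ : ℂ, s₁ μ 1 = 0) (h₁1 : ∀ μ : ℂ, s₁' μ 1 = 1)
    (k₀0 : ∀ μ : ℂ, t₀ μ 0 = 0) (k₀1 : ∀ μ : ℂ, t₀' μ 0 = 1)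
    (k₁0 : ∀ μ : ℂ, t₁ μ 1 = 0) (k₁1 : ∀ μ : ℂ, t₁' μ 1 = 1)
    (Δ Δt : ℂ → ℂ)
    (hΔ : ∀ μ : ℂ, ∀ x ∈ Icc (0:ℝ) 1,
      Δ (μ ^ 2) = s₀ μ x * s₁' μ x - s₀' μ x * s₁ μ x)
    (hΔt : ∀ μ : ℂ, ∀ x ∈ Icc (0:ℝ) 1,
      Δt (μ ^ 2) = t₀ μ x * t₁' μ x - t₀' μ x * t₁ μ x)
    (hsame : ∀ z : ℂ, Δ z = 0 ↔ Δt z = 0)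
    (hΔ0 : Δ 0 ≠ 0) (hΔt0 : Δt 0 ≠ 0) :
    ∀ μ : ℂ, Δ (μ ^ 2) = Δt (μ ^ 2) := by
  obtain ⟨r, hr⟩ : ∃ r : ℂ → ℂ, ∀ z, r z ^ 2 = z :=
    ⟨fun z => z ^ ((2:ℕ):ℂ)⁻¹, fun z => Complex.cpow_nat_inv_pow z two_ne_zero⟩
  have S : SLSys q (fun z => s₀ (r z)) (fun z => s₀' (r z)) (fun z => s₁ (r z))
      (fun z => s₁' (r z)) Δ := by
    refine ⟨fun z => ⟨hs₀ (r z), ?_⟩, fun z => ⟨hs₁ (r z), ?_⟩, fun z => h₀0 _, fun z => h₀1 _,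
      fun z => h₁0 _, fun z => h₁1 _, ?_, hΔ0⟩
    · have := hs₀' (r z); rw [hr] at this; simpa using this
    · have := hs₁' (r z); rw [hr] at this; simpa using this
    · intro z x hx; have := hΔ (r z) x hx; rwa [hr] at this
  have T : SLSys qt (fun z => t₀ (r z)) (fun z => t₀' (r z)) (fun z => t₁ (r z))
      (fun z => t₁' (r z)) Δt := by
    refine ⟨fun z => ⟨ht₀ (r z), ?_⟩, fun z => ⟨ht₁ (r z), ?_⟩, fun z => k₀0 _, fun z => k₀1 _,
      fun z => k₁0 _, fun z => k₁1 _, ?_, hΔt0⟩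
    · have := ht₀' (r z); rw [hr] at this; simpa using this
    · have := ht₁' (r z); rw [hr] at this; simpa using this
    · intro z x hx; have := hΔt (r z) x hx; rwa [hr] at this
  exact fun μ => S.eq T hq hqt hsame (μ ^ 2)
end
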